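/- Let R be a henselian local ring with maximal ideal 𝔪 satisfying 𝔪 ≠ 𝔪² and residue field k = R/𝔪. Let n be a positive integer and m the char(k)-free part of n, and assume s_m(k) < ∞. Assume that char(k) ∤ n, or that char(R) = char(k) and R is reduced. Then w_n(R) = max{w_m(k), s_m(k)+1} if m > 1, and w_n(R) = 1 if m = 1. -/

import Mathlib

/-- `a` is a sum of finitely many `n`-th powers in `R`. -/
def IsSumOfPowers (R : Type*) [CommRing R] (n : ℕ) (a : R) : Prop :=
  ∃ l : ℕ, ∃ x : Fin l → R, a = ∑ i, x i ^ n

/-- The `n`-length of `a ∈ R`: the least positive integer `g` such that `a` is a sum of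
`g` `n`-th powers of elements of `R`, or `∞` if no such `g` exists. -/
noncomputable def nLength (R : Type*) [CommRing R] (n : ℕ) (a : R) : ℕ∞ :=
  sInf {g : ℕ∞ | ∃ l : ℕ, g = l ∧ 0 < l ∧ ∃ x : Fin l → R, a = ∑ i, x i ^ n}

/-- The `n`-th level of `R`: `s_n(R) = ℓ_n(-1)`. -/
noncomputable def level (R : Type*) [CommRing R] (n : ℕ) : ℕ∞ :=
  nLength R n (-1)

/-- The `n`-th Waring number of `R`: the least positive integer `g` such that every element of
`R` which is a sum of finitely many `n`-th powers is a sum of at most `g` `n`-th powers,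
or `∞` if no such `g` exists. -/
noncomputable def waring (R : Type*) [CommRing R] (n : ℕ) : ℕ∞ :=
  sInf {g : ℕ∞ | ∃ l : ℕ, g = l ∧ 0 < l ∧
    ∀ a : R, IsSumOfPowers R n a → nLength R n a ≤ l}

/-- `m` is the `p`-free part of `n`: if `p = 0` then `m = n`, and otherwise `n = p ^ j * m`
with `p ∤ m`. -/
def IsFreePart (p n m : ℕ) : Prop :=
  (p = 0 ∧ m = n) ∨ (p ≠ 0 ∧ ¬ p ∣ m ∧ ∃ j : ℕ, n = p ^ j * m)

/-- `a` is a sum of exactly `l` `n`-th powers in `R`. -/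
def IsSumOfNPowers (R : Type*) [CommRing R] (n l : ℕ) (a : R) : Prop :=
  ∃ x : Fin l → R, a = ∑ i, x i ^ n

namespace IsSumOfNPowers

variable {R : Type*} [CommRing R] {n l : ℕ} {a : R}

lemma succ (hn : 0 < n) (h : IsSumOfNPowers R n l a) : IsSumOfNPowers R n (l + 1) a := by
  obtain ⟨x, rfl⟩ := h
  exact ⟨Fin.cons 0 x, by simp [Fin.sum_univ_succ, hn.ne']⟩

lemma mono (hn : 0 < n) {l' : ℕ} (hl : l ≤ l') (h : IsSumOfNPowers R n l a) :
    IsSumOfNPowers R n l' a := by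
  induction l', hl using Nat.le_induction with
  | base => exact h
  | succ _ _ ih => exact ih.succ hn

lemma map {S : Type*} [CommRing S] (f : R →+* S) (h : IsSumOfNPowers R n l a) :
    IsSumOfNPowers S n l (f a) := by
  obtain ⟨x, rfl⟩ := h
  exact ⟨fun i => f (x i), by simp⟩

end IsSumOfNPowers

section Basic

variable {R : Type*} [CommRing R] {n : ℕ}

lemma nLength_le_natCast_iff (hn : 0 < n) {l : ℕ} (hl : 0 < l) (a : R) :
    nLength R n a ≤ l ↔ IsSumOfNPowers R n l a := by
  constructor
  · intro h
    have hne : {g : ℕ∞ | ∃ l : ℕ, g = l ∧ 0 < l ∧ ∃ x : Fin l → R, a = ∑ i, x i ^ n}.Nonempty := by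
      by_contra hemp
      rw [Set.not_nonempty_iff_eq_empty] at hemp
      rw [nLength, hemp, sInf_empty, top_le_iff] at h
      exact ENat.natCast_ne_top l h
    obtain ⟨g, hg, -, hx⟩ := csInf_mem hne
    rw [nLength, hg, Nat.cast_le] at h
    exact IsSumOfNPowers.mono hn h hx
  · intro h
    exact sInf_le ⟨l, rfl, hl, h⟩

lemma one_le_nLength (a : R) : 1 ≤ nLength R n a := by
  refine le_sInf ?_
  rintro _ ⟨l, rfl, hl, -⟩
  exact_mod_cast hl

lemma one_le_waring : 1 ≤ waring R n := by
  refine le_sInf ?_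
  rintro _ ⟨l, rfl, hl, -⟩
  exact_mod_cast hl

lemma waring_le_natCast_iff (hn : 0 < n) {l : ℕ} (hl : 0 < l) :
    waring R n ≤ l ↔ ∀ a : R, IsSumOfPowers R n a → IsSumOfNPowers R n l a := by
  constructor
  · intro h a ha
    have hne : {g : ℕ∞ | ∃ l : ℕ, g = l ∧ 0 < l ∧
        ∀ a : R, IsSumOfPowers R n a → nLength R n a ≤ l}.Nonempty := by
      by_contra hemp
      rw [Set.not_nonempty_iff_eq_empty] at hemp
      rw [waring, hemp, sInf_empty, top_le_iff] at h
      exact ENat.natCast_ne_top l h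
    obtain ⟨g, hg, hg0, hx⟩ := csInf_mem hne
    rw [waring, hg, Nat.cast_le] at h
    exact ((nLength_le_natCast_iff hn hg0 a).1 (hx a ha)).mono hn h
  · intro h
    exact sInf_le ⟨l, rfl, hl, fun a ha => (nLength_le_natCast_iff hn hl a).2 (h a ha)⟩

lemma level_add_one_le_natCast_iff [Nontrivial R] (hn : 0 < n) (l : ℕ) :
    level R n + 1 ≤ ((l + 1 : ℕ) : ℕ∞) ↔ IsSumOfNPowers R n l (-1) := by
  rw [Nat.cast_add, Nat.cast_one, ENat.add_le_add_iff_right (by simp)]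
  rcases Nat.eq_zero_or_pos l with rfl | hl
  · refine iff_of_false (fun h => ?_) (fun ⟨x, hx⟩ => by simp at hx)
    exact absurd ((one_le_nLength (-1 : R)).trans h) (by simp)
  · exact nLength_le_natCast_iff hn hl (-1)

lemma ENat.eq_of_forall_le_natCast_succ_iff {x y : ℕ∞} (hx : 1 ≤ x) (hy : 1 ≤ y)
    (h : ∀ l : ℕ, x ≤ ((l + 1 : ℕ) : ℕ∞) ↔ y ≤ ((l + 1 : ℕ) : ℕ∞)) : x = y := by
  have key : ∀ {x y : ℕ∞}, 1 ≤ y →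
      (∀ l : ℕ, y ≤ ((l + 1 : ℕ) : ℕ∞) → x ≤ ((l + 1 : ℕ) : ℕ∞)) → x ≤ y := by
    intro x y hy h
    induction y with
    | top => exact le_top
    | coe b =>
      obtain ⟨c, rfl⟩ := Nat.exists_eq_succ_of_ne_zero (n := b) (by rintro rfl; simp at hy)
      exact h c le_rfl
  exact le_antisymm (key hy fun l => (h l).2) (key hx fun l => (h l).1)

lemma waring_one : waring R 1 = 1 := by
  refine le_antisymm ?_ one_le_waring
  exact_mod_cast (waring_le_natCast_iff (R := R) one_pos one_pos).2
    fun a _ => ⟨fun _ => a, by simp⟩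

/-- In a reduced ring of characteristic `p`, the factor `p ^ j` of the exponent does not affect
the Waring number. -/
lemma waring_prime_pow_mul (p : ℕ) [Fact p.Prime] [CharP R p] [IsReduced R] (j : ℕ) {m : ℕ}
    (hm : 0 < m) : waring R (p ^ j * m) = waring R m := by
  have hp : 0 < p := (Fact.out : p.Prime).pos
  have hsum : ∀ {l : ℕ} (x : Fin l → R),
      ∑ i, x i ^ (p ^ j * m) = (∑ i, x i ^ m) ^ p ^ j := by
    intro l x
    rw [sum_pow_char_pow]
    exact Finset.sum_congr rfl fun i _ => by rw [mul_comm, pow_mul]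
  have hinj : Function.Injective fun x : R => x ^ p ^ j := iterateFrobenius_inj R p j
  refine ENat.eq_of_forall_le_natCast_succ_iff one_le_waring one_le_waring fun l => ?_
  rw [waring_le_natCast_iff (by positivity) l.succ_pos, waring_le_natCast_iff hm l.succ_pos]
  constructor
  · rintro h _ ⟨g, x, rfl⟩
    obtain ⟨y, hy⟩ := h ((∑ i, x i ^ m) ^ p ^ j) ⟨g, x, (hsum x).symm⟩
    exact ⟨y, hinj (hy.trans (hsum y))⟩
  · rintro h _ ⟨g, x, rfl⟩
    obtain ⟨y, hy⟩ := h (∑ i, x i ^ m) ⟨g, x, rfl⟩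
    exact ⟨y, by rw [hsum, hsum, hy]⟩

end Basic

section Henselian

open IsLocalRing Polynomial

variable {R : Type*} [CommRing R] [HenselianLocalRing R] {n : ℕ}

lemma HenselianLocalRing.exists_pow_eq (hn : (n : ResidueField R) ≠ 0) {b c : R}
    (hb : residue R b ≠ 0) (h : residue R b ^ n = residue R c) : ∃ y : R, y ^ n = c := by
  have hn0 : n ≠ 0 := by rintro rfl; simp at hn
  obtain ⟨y, hy, -⟩ := HenselianLocalRing.is_henselian (X ^ n - C c)
    (monic_X_pow_sub_C c hn0) b (by rw [← residue_eq_zero_iff]; simp [h])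
    (by
      rw [← residue_ne_zero_iff_isUnit]
      simp [derivative_X_pow, hn, hb])
  exact ⟨y, by simpa [sub_eq_zero] using hy⟩

lemma IsSumOfNPowers.of_residue (hn : (n : ResidueField R) ≠ 0) {l : ℕ} {a : R}
    {y : Fin (l + 1) → ResidueField R} (i : Fin (l + 1)) (hi : y i ≠ 0)
    (h : residue R a = ∑ j, y j ^ n) : IsSumOfNPowers R n (l + 1) a := by
  choose x hx using fun j => residue_surjective (R := R) (y j)
  obtain ⟨z, hz⟩ := HenselianLocalRing.exists_pow_eq hn (b := x i)
    (c := a - ∑ j, x (i.succAbove j) ^ n) (by rwa [hx]) (by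
      rw [Fin.sum_univ_succAbove _ i] at h
      simp [hx, h])
  refine ⟨i.insertNth z fun j => x (i.succAbove j), ?_⟩
  rw [Fin.sum_univ_succAbove _ i]
  simp [hz]

lemma IsSumOfNPowers.of_mem_maximalIdeal (hn : (n : ResidueField R) ≠ 0) {l : ℕ}
    (h : IsSumOfNPowers (ResidueField R) n l (-1)) {a : R} (ha : a ∈ maximalIdeal R) :
    IsSumOfNPowers R n (l + 1) a := by
  obtain ⟨y, hy⟩ := h
  refine .of_residue hn (y := Fin.cons 1 y) 0 (by simp) ?_
  rw [(residue_eq_zero_iff a).2 ha]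
  simp [Fin.sum_univ_succ, ← hy]

lemma IsSumOfNPowers.of_isUnit (hn : (n : ResidueField R) ≠ 0) {l : ℕ} {a : R}
    (ha : residue R a ≠ 0) (h : IsSumOfNPowers (ResidueField R) n (l + 1) (residue R a)) :
    IsSumOfNPowers R n (l + 1) a := by
  have hn0 : n ≠ 0 := by rintro rfl; simp at hn
  obtain ⟨y, hy⟩ := h
  obtain ⟨i, hi⟩ : ∃ i, y i ≠ 0 := by
    by_contra! hall
    exact ha (by simp [hy, hall, hn0])
  exact .of_residue hn i hi hy

/-- An element of `𝔪 \ 𝔪 ^ 2` can only be a sum of `l + 1` many `n`-th powers, `n ≥ 2`, if `-1`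
is a sum of `l` many `n`-th powers in the residue field. -/
lemma IsSumOfNPowers.neg_one_of_notMem_sq {R : Type*} [CommRing R] [IsLocalRing R] {n : ℕ}
    (hn : 1 < n) {l : ℕ} {a : R} (ha : a ∈ maximalIdeal R) (ha' : a ∉ maximalIdeal R ^ 2)
    (h : IsSumOfNPowers R n (l + 1) a) : IsSumOfNPowers (ResidueField R) n l (-1) := by
  obtain ⟨x, rfl⟩ := h
  obtain ⟨i, hi⟩ : ∃ i, x i ∉ maximalIdeal R := by
    by_contra! hall
    exact ha' (Ideal.sum_mem _ fun i _ =>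
      Ideal.pow_le_pow_right hn (Ideal.pow_mem_pow (hall i) n))
  rw [← residue_eq_zero_iff] at ha hi
  refine ⟨fun j => residue R (x (i.succAbove j)) / residue R (x i), ?_⟩
  rw [Fin.sum_univ_succAbove _ i] at ha
  simp only [map_add, map_sum, map_pow] at ha
  simp only [div_pow]
  rw [← Finset.sum_div, eq_div_iff (pow_ne_zero _ hi)]
  linear_combination -ha

lemma waring_eq_max_of_natCast_ne_zero (hn1 : 1 < n) (hn : (n : ResidueField R) ≠ 0)
    (h𝔪 : maximalIdeal R ≠ maximalIdeal R ^ 2) (hlev : level (ResidueField R) n < ⊤) :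
    waring R n = max (waring (ResidueField R) n) (level (ResidueField R) n + 1) := by
  have hn0 : 0 < n := by lia
  obtain ⟨a, ha, ha'⟩ : ∃ a ∈ maximalIdeal R, a ∉ maximalIdeal R ^ 2 := by
    by_contra! hall
    exact h𝔪 (le_antisymm hall (Ideal.pow_le_self two_ne_zero))
  obtain ⟨s, hs⟩ := ENat.ne_top_iff_exists.1 hlev.ne
  have hs' : IsSumOfNPowers (ResidueField R) n s (-1) :=
    (level_add_one_le_natCast_iff hn0 s).1 (by rw [← hs]; norm_cast)
  refine ENat.eq_of_forall_le_natCast_succ_iff one_le_waring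
    (one_le_waring.trans (le_max_left _ _)) fun l => ?_
  rw [max_le_iff, level_add_one_le_natCast_iff hn0, waring_le_natCast_iff hn0 l.succ_pos,
    waring_le_natCast_iff hn0 l.succ_pos]
  constructor
  · refine fun h => ⟨?_, (h a ⟨s + 1, hs'.of_mem_maximalIdeal hn ha⟩).neg_one_of_notMem_sq
      hn1 ha ha'⟩
    rintro _ ⟨g, y, rfl⟩
    choose x hx using fun j => residue_surjective (R := R) (y j)
    simpa [hx] using (h (∑ j, x j ^ n) ⟨g, x, rfl⟩).map (residue R)
  · rintro ⟨h, h'⟩ b ⟨g, x, hb⟩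
    by_cases hb0 : residue R b = 0
    · exact h'.of_mem_maximalIdeal hn ((residue_eq_zero_iff b).1 hb0)
    · exact .of_isUnit hn hb0 (h _ ⟨g, IsSumOfNPowers.map (residue R) ⟨x, hb⟩⟩)

end Henselian

/-- Let `R` be a henselian local ring with maximal ideal `𝔪 ≠ 𝔪²` and residue
field `k`, `n` a positive integer with `char(k)`-free part `m`, `s_m(k) < ∞`. Assume
`char(k) ∤ n`, or `char(R) = char(k)` and `R` is reduced. Then
`w_n(R) = max {w_m(k), s_m(k) + 1}` if `m > 1`, and `w_n(R) = 1` if `m = 1`. -/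
theorem waring_of_henselianLocalRing (R : Type*) [CommRing R] [HenselianLocalRing R]
    (n m : ℕ) (hn : 0 < n)
    (hm : IsFreePart (ringChar (IsLocalRing.ResidueField R)) n m)
    (h𝔪 : IsLocalRing.maximalIdeal R ≠ (IsLocalRing.maximalIdeal R) ^ 2)
    (hchar : ¬ ringChar (IsLocalRing.ResidueField R) ∣ n ∨
      (ringChar R = ringChar (IsLocalRing.ResidueField R) ∧ IsReduced R))
    (hlev : level (IsLocalRing.ResidueField R) m < ⊤) :
    (1 < m → waring R n = max (waring (IsLocalRing.ResidueField R) m)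
      (level (IsLocalRing.ResidueField R) m + 1)) ∧
      (m = 1 → waring R n = 1) := by
  set k := IsLocalRing.ResidueField R
  have hcast : ∀ {r : ℕ}, ¬ ringChar k ∣ r → (r : k) ≠ 0 := fun h h0 =>
    h ((ringChar.spec k _).1 h0)
  obtain ⟨hmk, hw⟩ : (m : k) ≠ 0 ∧ waring R n = waring R m := by
    rcases hm with ⟨hp, rfl⟩ | ⟨hp, hpm, j, rfl⟩
    · exact ⟨hcast (by rw [hp, zero_dvd_iff]; exact hn.ne'), rfl⟩
    · refine ⟨hcast hpm, ?_⟩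
      rcases hchar with hndvd | ⟨hR, hred⟩
      · obtain rfl : j = 0 := by
          by_contra hj
          exact hndvd ((dvd_pow_self _ hj).mul_right m)
        simp
      · have : Fact (ringChar k).Prime := ⟨(CharP.char_is_prime_or_zero k _).resolve_right hp⟩
        have : CharP R (ringChar k) := ringChar.of_eq hR
        exact waring_prime_pow_mul _ j (Nat.pos_of_mul_pos_left hn)
  exact ⟨fun h1 => hw.trans (waring_eq_max_of_natCast_ne_zero h1 hmk h𝔪 hlev),
    fun h1 => by rw [hw, h1, waring_one]⟩
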